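/- arXiv:2403.16480 — 3 statements merged into one kernel-verified Lean document; each statement's English description precedes it below -/
import Mathlib

section
/- Let μ be a unit pure quaternion, A ∈ ℍ^{n₁×n₂×n₃}, and let A = U *_μ S *_μ V* be a gQt-SVD in which U ∈ ℍ^{n₁×n₁×n₃} and V ∈ ℍ^{n₂×n₂×n₃} are unitary tensors, S ∈ ℍ^{n₁×n₂×n₃} is f-diagonal, and for each l the l-th frontal slice of fft(S) is a real nonnegative diagonal matrix with nonincreasing diagonal entries. For k < min(n₁,n₂), set A_k = Σ_{i=1}^{k} U(:,i,:) *_μ S(i,i,:) *_μ V(:,i,:)*, a sum of gQt-products of the lateral slices U(:,i,:) ∈ ℍ^{n₁×1×n₃}, the tubes S(i,i,:) ∈ ℍ^{1×1×n₃}, and the conjugate transposes V(:,i,:)* ∈ ℍ^{1×n₂×n₃}. Then ‖A − C‖_F ≥ ‖A − A_k‖_F for every tensor C of the form C = X *_μ Y with X ∈ ℍ^{n₁×k×n₃} and Y ∈ ℍ^{k×n₂×n₃}; i.e., A_k is a best Frobenius-norm approximation of A among tensors of gQt-rank at most k. -/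
noncomputable section
open Matrix Kronecker Filter Topology

namespace QTpaper

/-- The quaternion unit `i`. -/
def qi : Quaternion ℝ := ⟨0, 1, 0, 0⟩
/-- The quaternion unit `j`. -/
def qj : Quaternion ℝ := ⟨0, 0, 1, 0⟩
/-- The quaternion unit `k`. -/
def qk : Quaternion ℝ := ⟨0, 0, 0, 1⟩

/-- A unit pure quaternion: zero real part and norm one. -/
def UnitPure (μ : Quaternion ℝ) : Prop := μ.re = 0 ∧ ‖μ‖ = 1

/-- Third-order quaternion tensors. -/
abbrev QTensor (a b c : ℕ) := Fin a → Fin b → Fin c → Quaternion ℝ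

/-- `l`-th frontal slice of a third-order tensor. -/
def fslice {a b c : ℕ} (A : QTensor a b c) (l : Fin c) :
    Matrix (Fin a) (Fin b) (Quaternion ℝ) := fun p q => A p q l

/-- Frobenius norm of a quaternion matrix. -/
def frobM {m n : ℕ} (A : Matrix (Fin m) (Fin n) (Quaternion ℝ)) : ℝ :=
  Real.sqrt (∑ p, ∑ q, ‖A p q‖ ^ 2)

/-- Frobenius norm of a third-order quaternion tensor. -/
def frobT {a b c : ℕ} (A : QTensor a b c) : ℝ :=
  Real.sqrt (∑ p, ∑ q, ∑ l, ‖A p q l‖ ^ 2)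

/-- The normalized QDFT matrix `F_{μ,n}` with entries
`(1/√n)·ω^{(p-1)(q-1)}`, `ω^m = cos(2πm/n) − μ·sin(2πm/n)`. -/
def Fq (μ : Quaternion ℝ) (n : ℕ) : Matrix (Fin n) (Fin n) (Quaternion ℝ) :=
  fun p q =>
    ((1 / Real.sqrt n : ℝ) : Quaternion ℝ) *
      (((Real.cos (2 * Real.pi * (p.1 * q.1) / n) : ℝ) : Quaternion ℝ)
        - ((Real.sin (2 * Real.pi * (p.1 * q.1) / n) : ℝ) : Quaternion ℝ) * μ)

/-- The permutation matrix `P_n` (1-based: `P₁₁ = 1`, `P_{pq} = 1` for `p+q = n+2`). -/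
def Pmat (n : ℕ) : Matrix (Fin n) (Fin n) ℝ :=
  fun p q => if (p.1 = 0 ∧ q.1 = 0) ∨ (p.1 + q.1 = n) then 1 else 0

/-- Block circulant matrix of a third-order tensor. -/
def circ {a b c : ℕ} (A : QTensor a b c) :
    Matrix (Fin c × Fin a) (Fin c × Fin b) (Quaternion ℝ) :=
  fun pi qj => A pi.2 qj.2 (pi.1 - qj.1)

/-- `unfold` stacks the frontal slices vertically. -/
def unfold3 {a b c : ℕ} (A : QTensor a b c) :
    Matrix (Fin c × Fin a) (Fin b) (Quaternion ℝ) :=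
  fun pi q => A pi.2 q pi.1

/-- `fold` is the inverse of `unfold`. -/
def fold3 {a b c : ℕ} (M : Matrix (Fin c × Fin a) (Fin b) (Quaternion ℝ)) :
    QTensor a b c := fun p q l => M (l, p) q

/-- Block diagonal matrix whose `l`-th diagonal block is the `l`-th frontal slice. -/
def diagT {a b c : ℕ} (A : QTensor a b c) :
    Matrix (Fin c × Fin a) (Fin c × Fin b) (Quaternion ℝ) :=
  fun pi qj => if pi.1 = qj.1 then A pi.2 qj.2 pi.1 else 0

/-- The QDFT along mode 3: `fft(A)(p,q,:) = √n₃ · F_{μ,n₃} · A(p,q,:)`. -/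
def fftT {a b c : ℕ} (μ : Quaternion ℝ) (A : QTensor a b c) : QTensor a b c :=
  fun p q l => ((Real.sqrt c : ℝ) : Quaternion ℝ) * ∑ m, Fq μ c l m * A p q m

/-- Real-part component tensor. -/
def compE {a b c : ℕ} (A : QTensor a b c) : QTensor a b c :=
  fun p q l => (((A p q l).re : ℝ) : Quaternion ℝ)
/-- `i`-component tensor. -/
def compI {a b c : ℕ} (A : QTensor a b c) : QTensor a b c :=
  fun p q l => (((A p q l).imI : ℝ) : Quaternion ℝ)
/-- `j`-component tensor. -/
def compJ {a b c : ℕ} (A : QTensor a b c) : QTensor a b c :=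
  fun p q l => (((A p q l).imJ : ℝ) : Quaternion ℝ)
/-- `k`-component tensor. -/
def compK {a b c : ℕ} (A : QTensor a b c) : QTensor a b c :=
  fun p q l => (((A p q l).imK : ℝ) : Quaternion ℝ)

/-- For `μ = a·i + b·j + c·k`, `μ_i = a·i − b·j − c·k`. -/
def mui (μ : Quaternion ℝ) : Quaternion ℝ := ⟨0, μ.imI, -μ.imJ, -μ.imK⟩
/-- For `μ = a·i + b·j + c·k`, `μ_j = −a·i + b·j − c·k`. -/
def muj (μ : Quaternion ℝ) : Quaternion ℝ := ⟨0, -μ.imI, μ.imJ, -μ.imK⟩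
/-- For `μ = a·i + b·j + c·k`, `μ_k = −a·i − b·j + c·k`. -/
def muk (μ : Quaternion ℝ) : Quaternion ℝ := ⟨0, -μ.imI, -μ.imJ, μ.imK⟩

/-- `T` matrix `F_{ν,n}^* · F_{μ,n}`. -/
def Tm (ν μ : Quaternion ℝ) (n : ℕ) : Matrix (Fin n) (Fin n) (Quaternion ℝ) :=
  (Fq ν n)ᴴ * Fq μ n

/-- The gQt-product of third-order quaternion tensors. -/
def gQt {n₁ r n₂ n₃ : ℕ} (μ : Quaternion ℝ) (A : QTensor n₁ r n₃)
    (B : QTensor r n₂ n₃) : QTensor n₁ n₂ n₃ :=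
  fold3 ((circ (compE A)
      + qi • (circ (compI A) * (Tm (mui μ) μ n₃ ⊗ₖ (1 : Matrix (Fin r) (Fin r) (Quaternion ℝ))))
      + qj • (circ (compJ A) * (Tm (muj μ) μ n₃ ⊗ₖ (1 : Matrix (Fin r) (Fin r) (Quaternion ℝ))))
      + qk • (circ (compK A) * (Tm (muk μ) μ n₃ ⊗ₖ (1 : Matrix (Fin r) (Fin r) (Quaternion ℝ)))))
    * unfold3 B)

/-- The index reversal `1 ↦ 1`, `l ↦ n₃ + 2 − l` (1-based), used in the tensor transpose. -/
def revIdx {c : ℕ} (l : Fin c) : Fin c :=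
  if h : l.1 = 0 then l else ⟨c - l.1, by have := l.2; omega⟩

/-- Transpose of a (componentwise real) tensor: transpose each frontal slice and
reverse the order of the transposed slices `2` through `n₃`. -/
def transT {a b c : ℕ} (A : QTensor a b c) : QTensor b a c :=
  fun q p l => A p q (revIdx l)

/-- Right multiplication of a matrix by a quaternion scalar. -/
def rmulM {m n : Type*} (M : Matrix m n (Quaternion ℝ)) (x : Quaternion ℝ) :
    Matrix m n (Quaternion ℝ) := fun p q => M p q * x

/-- Conjugate transpose of a third-order quaternion tensor. -/
def conjT {n₁ n₂ n₃ : ℕ} (μ : Quaternion ℝ) (A : QTensor n₁ n₂ n₃) : QTensor n₂ n₁ n₃ :=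
  fold3 (unfold3 (transT (compE A))
    - rmulM (((Tm (mui μ) μ n₃)ᴴ ⊗ₖ (1 : Matrix (Fin n₂) (Fin n₂) (Quaternion ℝ)))
        * unfold3 (transT (compI A))) qi
    - rmulM (((Tm (muj μ) μ n₃)ᴴ ⊗ₖ (1 : Matrix (Fin n₂) (Fin n₂) (Quaternion ℝ)))
        * unfold3 (transT (compJ A))) qj
    - rmulM (((Tm (muk μ) μ n₃)ᴴ ⊗ₖ (1 : Matrix (Fin n₂) (Fin n₂) (Quaternion ℝ)))
        * unfold3 (transT (compK A))) qk)

/-- The identity tensor: first frontal slice is the identity, the others vanish. -/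
def idT (n l : ℕ) : QTensor n n l :=
  fun p q m => if m.1 = 0 ∧ p = q then 1 else 0

/-- Unitary tensor with respect to the gQt-product. -/
def unitaryT {n n₃ : ℕ} (μ : Quaternion ℝ) (U : QTensor n n n₃) : Prop :=
  gQt μ (conjT μ U) U = idT n n₃ ∧ gQt μ U (conjT μ U) = idT n n₃

/-- f-diagonal tensor: each frontal slice is a diagonal matrix. -/
def fDiag {a b c : ℕ} (S : QTensor a b c) : Prop :=
  ∀ p q l, p.1 ≠ q.1 → S p q l = 0

section FrobeniusSquare

lemma conjTranspose_smul_real {m n : Type*} (c : ℝ) (M : Matrix m n (Quaternion ℝ)) :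
    (c • M)ᴴ = c • Mᴴ := by
  ext1 p q
  simp [Quaternion.star_smul]

variable {m n r : Type*} [Fintype m] [Fintype n] [Fintype r]

/-- The squared Frobenius norm of a quaternion matrix. -/
def frobSq (M : Matrix m n (Quaternion ℝ)) : ℝ := ∑ p, ∑ q, ‖M p q‖ ^ 2

lemma frobSq_nonneg (M : Matrix m n (Quaternion ℝ)) : 0 ≤ frobSq M :=
  Finset.sum_nonneg fun _ _ => Finset.sum_nonneg fun _ _ => sq_nonneg _

lemma re_sum {ι : Type*} (s : Finset ι) (f : ι → Quaternion ℝ) :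
    (∑ i ∈ s, f i).re = ∑ i ∈ s, (f i).re := by
  classical
  induction s using Finset.induction_on with
  | empty => rfl
  | insert a s ha ih => simp [Finset.sum_insert ha, ih]

lemma coe_sum {ι : Type*} (s : Finset ι) (f : ι → ℝ) :
    ((∑ i ∈ s, f i : ℝ) : Quaternion ℝ) = ∑ i ∈ s, (f i : Quaternion ℝ) :=
  map_sum (algebraMap ℝ (Quaternion ℝ)) f s

lemma re_mul_comm (a b : Quaternion ℝ) : (a * b).re = (b * a).re := by
  simp only [Quaternion.re_mul]; ring

lemma re_mul_star_self (a : Quaternion ℝ) : (a * star a).re = ‖a‖ ^ 2 := by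
  rw [Quaternion.self_mul_star, Quaternion.re_coe, Quaternion.normSq_eq_norm_mul_self, sq]

lemma re_trace_mul_comm (M : Matrix m n (Quaternion ℝ)) (N : Matrix n m (Quaternion ℝ)) :
    (trace (M * N)).re = (trace (N * M)).re := by
  simp only [trace, diag, mul_apply, re_sum]
  rw [Finset.sum_comm]
  simp only [re_mul_comm]

lemma re_trace_mul_conjTranspose (M : Matrix m n (Quaternion ℝ)) :
    (trace (M * Mᴴ)).re = frobSq M := by
  simp only [trace, diag, mul_apply, re_sum, conjTranspose_apply, re_mul_star_self, frobSq]

lemma re_trace_conjTranspose_mul (M : Matrix m n (Quaternion ℝ)) :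
    (trace (Mᴴ * M)).re = frobSq M := by
  rw [re_trace_mul_comm, re_trace_mul_conjTranspose]

lemma frobSq_isometry_mul [DecidableEq n] {U : Matrix m n (Quaternion ℝ)} (hU : Uᴴ * U = 1)
    (M : Matrix n r (Quaternion ℝ)) : frobSq (U * M) = frobSq M := by
  rw [← re_trace_conjTranspose_mul, conjTranspose_mul, Matrix.mul_assoc, ← Matrix.mul_assoc Uᴴ, hU,
    Matrix.one_mul, re_trace_conjTranspose_mul]

lemma frobSq_mul_conjTranspose_isometry [DecidableEq n] {V : Matrix m n (Quaternion ℝ)}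
    (hV : Vᴴ * V = 1) (M : Matrix r n (Quaternion ℝ)) : frobSq (M * Vᴴ) = frobSq M := by
  rw [← re_trace_mul_conjTranspose, conjTranspose_mul, conjTranspose_conjTranspose,
    Matrix.mul_assoc, ← Matrix.mul_assoc Vᴴ, hV, Matrix.one_mul, re_trace_mul_conjTranspose]

lemma frobSq_eq_zero_iff {M : Matrix m n (Quaternion ℝ)} : frobSq M = 0 ↔ M = 0 := by
  constructor
  · intro h
    ext1 p q
    have h1 := (Finset.sum_eq_zero_iff_of_nonneg
      (fun _ _ => Finset.sum_nonneg fun _ _ => sq_nonneg _)).1 h p (Finset.mem_univ p)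
    have h2 := (Finset.sum_eq_zero_iff_of_nonneg (fun _ _ => sq_nonneg _)).1 h1 q
      (Finset.mem_univ q)
    simpa using h2
  · rintro rfl
    simp [frobSq]

lemma conjTranspose_mul_self_of_unit (y : Matrix m Unit (Quaternion ℝ)) :
    yᴴ * y = frobSq y • (1 : Matrix Unit Unit (Quaternion ℝ)) := by
  ext1 a b
  have h : ∀ x : Quaternion ℝ, star x * x = ((‖x‖ ^ 2 : ℝ) : Quaternion ℝ) := fun x => by
    rw [Quaternion.star_mul_self, Quaternion.normSq_eq_norm_mul_self, sq]
  simp only [mul_apply, conjTranspose_apply, h, frobSq, Matrix.smul_apply, Subsingleton.elim a b,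
    one_apply_eq, Finset.univ_unique, Finset.sum_singleton]
  rw [← coe_sum, ← Quaternion.coe_mul_eq_smul, mul_one]

lemma exists_orthogonal_projection [DecidableEq m] (k : ℕ) (X : Matrix m (Fin k) (Quaternion ℝ)) :
    ∃ P : Matrix m m (Quaternion ℝ), Pᴴ = P ∧ P * P = P ∧ P * X = X ∧ (trace P).re ≤ k := by
  induction k with
  | zero => exact ⟨0, by simp, by simp, by ext1 p q; exact q.elim0, by simp [Quaternion.re_zero]⟩
  | succ k ih =>
    obtain ⟨P, hPs, hPP, hPX, hPt⟩ := ih (fun p q => X p q.castSucc)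
    set X' : Matrix m (Fin k) (Quaternion ℝ) := fun p q => X p q.castSucc with hX'
    let x : Matrix m Unit (Quaternion ℝ) := fun p _ => X p (Fin.last k)
    have key : ∀ Q : Matrix m m (Quaternion ℝ), Q * X' = X' → Q * x = x → Q * X = X := by
      intro Q h1 h2
      ext1 p q
      refine Fin.lastCases ?_ (fun q => ?_) q
      · exact congrFun (congrFun h2 p) ()
      · exact congrFun (congrFun h1 p) q
    set y := x - P * x with hy
    have hPy : P * y = 0 := by rw [hy, Matrix.mul_sub, ← Matrix.mul_assoc, hPP, sub_self]
    have hyP : yᴴ * P = 0 := by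
      rw [← conjTranspose_conjTranspose (yᴴ * P), conjTranspose_mul, hPs,
        conjTranspose_conjTranspose, hPy, conjTranspose_zero]
    by_cases h0 : frobSq y = 0
    · refine ⟨P, hPs, hPP, key P hPX ?_, hPt.trans (by push_cast; linarith)⟩
      rw [frobSq_eq_zero_iff, hy, sub_eq_zero] at h0
      exact h0.symm
    · have hyy := conjTranspose_mul_self_of_unit y
      refine ⟨P + (frobSq y)⁻¹ • (y * yᴴ), ?_, ?_, key _ ?_ ?_, ?_⟩
      · rw [conjTranspose_add, hPs, conjTranspose_smul_real, conjTranspose_mul,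
          conjTranspose_conjTranspose]
      · have h4 : y * yᴴ * (y * yᴴ) = frobSq y • (y * yᴴ) := by
          rw [Matrix.mul_assoc, ← Matrix.mul_assoc yᴴ, hyy]; simp
        rw [Matrix.add_mul, Matrix.mul_add, Matrix.mul_add, hPP, Matrix.mul_smul,
          ← Matrix.mul_assoc P, hPy, Matrix.smul_mul, Matrix.mul_assoc y, hyP, Matrix.smul_mul,
          Matrix.mul_smul, h4, smul_smul (frobSq y)⁻¹ (frobSq y), inv_mul_cancel₀ h0]
        simp
      · have : yᴴ * X' = 0 := by rw [← hPX, ← Matrix.mul_assoc, hyP, Matrix.zero_mul]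
        rw [Matrix.add_mul, hPX, Matrix.smul_mul, Matrix.mul_assoc, this]
        simp
      · have h5 : x = y + P * x := by rw [hy]; abel
        have h6 : yᴴ * x = yᴴ * y := by
          conv_lhs => rw [h5]
          rw [Matrix.mul_add, ← Matrix.mul_assoc, hyP, Matrix.zero_mul, add_zero]
        rw [Matrix.add_mul, Matrix.smul_mul, Matrix.mul_assoc, h6, hyy, Matrix.mul_smul, smul_smul,
          inv_mul_cancel₀ h0, one_smul, Matrix.mul_one, hy]
        abel
      · rw [trace_add, trace_smul, Quaternion.re_add, Quaternion.re_smul,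
          re_trace_mul_conjTranspose, smul_eq_mul, inv_mul_cancel₀ h0]
        push_cast
        linarith

end FrobeniusSquare

lemma sum_mul_le_sum_lt {n k : ℕ} (hk : k < n) {s w : Fin n → ℝ} (hs : Antitone s)
    (hs0 : ∀ p, 0 ≤ s p) (hw0 : ∀ p, 0 ≤ w p) (hw1 : ∀ p, w p ≤ 1) (hw : ∑ p, w p ≤ k) :
    ∑ p, s p * w p ≤ ∑ p, if p.1 < k then s p else 0 := by
  set t := s ⟨k, hk⟩ with ht
  have hcard : ∑ p : Fin n, (if p.1 < k then (1 : ℝ) else 0) = k := by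
    rw [Fin.sum_univ_eq_sum_range (fun p => if p < k then (1 : ℝ) else 0), ← Finset.sum_filter,
      Finset.sum_const, nsmul_eq_mul, mul_one]
    congr 1
    rw [show (Finset.range n).filter (· < k) = Finset.range k by
      ext a; simp only [Finset.mem_filter, Finset.mem_range]; omega, Finset.card_range]
  have h : ∀ p, s p * w p ≤ (if p.1 < k then s p else 0) + t * w p
      - t * (if p.1 < k then 1 else 0) := by
    intro p
    split_ifs with hp
    · have : t ≤ s p := hs (Fin.mk_le_mk.2 hp.le)
      nlinarith [hw1 p]
    · have : s p ≤ t := hs (Fin.mk_le_mk.2 (not_lt.1 hp))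
      nlinarith [hw0 p]
  have h2 := Finset.sum_le_sum fun p (_ : p ∈ Finset.univ) => h p
  rw [Finset.sum_sub_distrib, Finset.sum_add_distrib, ← Finset.mul_sum, ← Finset.mul_sum,
    hcard] at h2
  nlinarith [hs0 ⟨k, hk⟩]

/-- The Eckart–Young inequality for a quaternion matrix whose rows are orthogonal with
nonincreasing norms. -/
lemma frobSq_truncation_le {n₁ k : ℕ} {n : Type*} [Fintype n] (hk : k < n₁)
    (D : Matrix (Fin n₁) n (Quaternion ℝ))
    (hD : ∀ p p', p ≠ p' → (D * Dᴴ) p p' = 0)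
    (hmono : Antitone fun p => ∑ q, ‖D p q‖ ^ 2)
    (X : Matrix (Fin n₁) (Fin k) (Quaternion ℝ)) (Y : Matrix (Fin k) n (Quaternion ℝ)) :
    frobSq (fun p q => if p.1 < k then 0 else D p q) ≤ frobSq (D - X * Y) := by
  obtain ⟨P, hPs, hPP, hPX, hPt⟩ := exists_orthogonal_projection k X
  have hbd : ∀ Q : Matrix (Fin n₁) (Fin n₁) (Quaternion ℝ), Qᴴ = Q → Q * Q = Q →
      ∀ p, 0 ≤ (Q p p).re := by
    intro Q h1 h2 p
    rw [← h2]
    nth_rw 2 [← h1]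
    simp only [mul_apply, conjTranspose_apply, re_sum, re_mul_star_self]
    positivity
  have hQs : (1 - P)ᴴ = 1 - P := by simp [hPs]
  have hQQ : (1 - P) * (1 - P) = 1 - P := by
    simp [Matrix.sub_mul, Matrix.mul_sub, hPP]
  set s : Fin n₁ → ℝ := fun p => ∑ q, ‖D p q‖ ^ 2 with hs
  have hdd : D * Dᴴ = diagonal fun p => ((s p : ℝ) : Quaternion ℝ) := by
    ext1 p p'
    by_cases h : p = p'
    · subst h
      have h' : ∀ x : Quaternion ℝ, x * star x = ((‖x‖ ^ 2 : ℝ) : Quaternion ℝ) := fun x => by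
        rw [Quaternion.self_mul_star, Quaternion.normSq_eq_norm_mul_self, sq]
      simp only [mul_apply, conjTranspose_apply, h', diagonal_apply_eq, hs]
      rw [coe_sum]
    · rw [hD p p' h, diagonal_apply_ne _ h]
  have hsplit : ∀ M : Matrix (Fin n₁) n (Quaternion ℝ), frobSq ((1 - P) * M) ≤ frobSq M := by
    intro M
    have h1 : ∀ Q : Matrix (Fin n₁) (Fin n₁) (Quaternion ℝ), Qᴴ = Q → Q * Q = Q →
        frobSq (Q * M) = (trace (Mᴴ * (Q * M))).re := by
      intro Q h1 h2
      rw [← re_trace_conjTranspose_mul, conjTranspose_mul, h1, Matrix.mul_assoc,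
        ← Matrix.mul_assoc Q, h2]
    have h2 : frobSq M = frobSq (P * M) + frobSq ((1 - P) * M) := by
      rw [h1 P hPs hPP, h1 _ hQs hQQ, ← Quaternion.re_add, ← trace_add, ← Matrix.mul_add,
        ← Matrix.add_mul, add_sub_cancel, Matrix.one_mul, re_trace_conjTranspose_mul]
    linarith [frobSq_nonneg (P * M)]
  refine le_trans ?_ (hsplit _)
  have h3 : (1 - P) * (D - X * Y) = (1 - P) * D := by
    rw [Matrix.mul_sub, ← Matrix.mul_assoc _ X, Matrix.sub_mul 1 P X, hPX]
    simp
  have h4 : frobSq ((1 - P) * D) = ∑ p, s p * (1 - (P p p).re) := by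
    rw [← re_trace_conjTranspose_mul, conjTranspose_mul, hQs, Matrix.mul_assoc,
      ← Matrix.mul_assoc (1 - P), hQQ, re_trace_mul_comm, Matrix.mul_assoc, hdd]
    simp only [trace, diag, mul_diagonal, re_sum]
    refine Finset.sum_congr rfl fun p _ => ?_
    rw [← Quaternion.coe_commutes, Quaternion.coe_mul_eq_smul, Quaternion.re_smul]
    simp [Quaternion.re_one]
  have h5 := sum_mul_le_sum_lt hk hmono (w := fun p => (P p p).re)
    (fun p => Finset.sum_nonneg fun _ _ => sq_nonneg _) (hbd P hPs hPP)
    (fun p => by simpa [Quaternion.re_one] using hbd _ hQs hQQ p)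
    (by simpa [trace, re_sum] using hPt)
  have h6 : frobSq (fun p q => if p.1 < k then 0 else D p q)
      = ∑ p, s p - ∑ p, if p.1 < k then s p else 0 := by
    rw [← Finset.sum_sub_distrib]
    refine Finset.sum_congr rfl fun p _ => ?_
    by_cases hp : p.1 < k <;> simp [hs, hp]
  rw [h3, h4, h6]
  simp only [mul_sub, mul_one, Finset.sum_sub_distrib]
  linarith

section Fourier

open scoped Quaternion

lemma UnitPure.mul_self {μ : Quaternion ℝ} (h : UnitPure μ) : μ * μ = -1 := by
  have h1 : star μ = -μ := Quaternion.star_eq_neg.2 h.1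
  have h2 := Quaternion.self_mul_star μ
  rw [h1, Quaternion.normSq_eq_norm_mul_self, h.2, mul_neg] at h2
  rw [← neg_neg (μ * μ), h2]
  simp

/-- The embedding `ℂ → ℍ` sending the imaginary unit to `-μ`. -/
def cEmb {μ : Quaternion ℝ} (h : UnitPure μ) : ℂ →ₐ[ℝ] Quaternion ℝ :=
  Complex.lift ⟨-μ, by rw [neg_mul_neg, h.mul_self]⟩

lemma cEmb_apply {μ : Quaternion ℝ} (h : UnitPure μ) (z : ℂ) :
    cEmb h z = (z.re : Quaternion ℝ) - (z.im : Quaternion ℝ) * μ := by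
  rw [cEmb, Complex.lift_apply, Complex.liftAux_apply, Quaternion.algebraMap_def,
    Quaternion.coe_mul_eq_smul, smul_neg, sub_eq_add_neg]

lemma cEmb_star {μ : Quaternion ℝ} (h : UnitPure μ) (z : ℂ) :
    cEmb h (star z) = star (cEmb h z) := by
  have h1 : star μ = -μ := Quaternion.star_eq_neg.2 h.1
  rw [cEmb_apply, cEmb_apply, star_sub, star_mul, h1]
  simp [Quaternion.coe_commutes]

/-- The primitive root of unity underlying the QDFT. -/
def zeta (n : ℕ) : ℂ := Complex.exp (2 * Real.pi * Complex.I / n)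

lemma zeta_pow (n a : ℕ) : zeta n ^ a =
    ⟨Real.cos (2 * Real.pi * a / n), Real.sin (2 * Real.pi * a / n)⟩ := by
  rw [zeta, ← Complex.exp_nat_mul,
    show (a : ℂ) * (2 * Real.pi * Complex.I / n) = ((2 * Real.pi * a / n : ℝ) : ℂ) * Complex.I by
      push_cast; ring]
  apply Complex.ext
  · exact Complex.exp_ofReal_mul_I_re _
  · exact Complex.exp_ofReal_mul_I_im _

lemma Fq_apply {μ : Quaternion ℝ} (h : UnitPure μ) (n : ℕ) (p q : Fin n) :
    Fq μ n p q = ((1 / Real.sqrt n : ℝ) : Quaternion ℝ) * cEmb h (zeta n ^ (p.1 * q.1)) := by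
  rw [cEmb_apply, zeta_pow, Fq]
  push_cast
  rfl

lemma star_zeta_mul (n a : ℕ) : star (zeta n ^ a) * zeta n ^ a = 1 := by
  rw [zeta_pow]
  apply Complex.ext
  · have := Real.sin_sq_add_cos_sq (2 * Real.pi * a / n)
    simp
    linarith
  · simp
    ring

lemma coe_sqrt_mul_self (n : ℕ) :
    ((1 / Real.sqrt n : ℝ) : Quaternion ℝ) * ((1 / Real.sqrt n : ℝ) : Quaternion ℝ)
      = ((1 / n : ℝ) : Quaternion ℝ) := by
  rw [← Quaternion.coe_mul]
  congr 1
  rw [div_mul_div_comm, one_mul, Real.mul_self_sqrt (Nat.cast_nonneg n)]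

lemma mulVec_unit_smul {n : ℕ} {μ ν u : Quaternion ℝ} (huν : μ * u = u * ν)
    (v : Fin n → Quaternion ℝ) :
    Fq μ n *ᵥ (u • v) = u • (Fq ν n *ᵥ v) := by
  ext1 l
  simp only [mulVec, dotProduct, Pi.smul_apply, smul_eq_mul, Finset.mul_sum]
  refine Finset.sum_congr rfl fun m _ => ?_
  rw [← mul_assoc, ← mul_assoc]
  congr 1
  simp only [Fq, mul_sub, sub_mul, Quaternion.coe_mul_eq_smul, Quaternion.mul_coe_eq_smul,
    smul_mul_assoc, mul_smul_comm, huν]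

/-- The unnormalized QDFT of a vector. -/
def dft {n : ℕ} (μ : Quaternion ℝ) (v : Fin n → Quaternion ℝ) : Fin n → Quaternion ℝ :=
  ((Real.sqrt n : ℝ) : Quaternion ℝ) • (Fq μ n *ᵥ v)

lemma dft_add {n : ℕ} (μ : Quaternion ℝ) (v w : Fin n → Quaternion ℝ) :
    dft μ (v + w) = dft μ v + dft μ w := by
  simp only [dft, mulVec_add, smul_add]

lemma dft_sub {n : ℕ} (μ : Quaternion ℝ) (v w : Fin n → Quaternion ℝ) :
    dft μ (v - w) = dft μ v - dft μ w := by
  simp only [dft, mulVec_sub, smul_sub]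

lemma dft_sum {n : ℕ} {ι : Type*} (μ : Quaternion ℝ) (s : Finset ι) (v : ι → Fin n → Quaternion ℝ) :
    dft μ (∑ i ∈ s, v i) = ∑ i ∈ s, dft μ (v i) := by
  simp only [dft, mulVec_sum, Finset.smul_sum]

variable {n : ℕ} [NeZero n]

lemma zeta_primitive : IsPrimitiveRoot (zeta n) n :=
  Complex.isPrimitiveRoot_exp n (NeZero.ne n)

lemma zeta_pow_add (l m q : Fin n) :
    zeta n ^ (l.1 * (m + q).1) = zeta n ^ (l.1 * m.1) * zeta n ^ (l.1 * q.1) := by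
  rw [← pow_add, ← mul_add, mul_comm l.1, mul_comm l.1, pow_mul, pow_mul, Fin.val_add,
    ← pow_mod_orderOf (zeta n) (m.1 + q.1), zeta_primitive.eq_orderOf.symm]

lemma zeta_sum (p q : Fin n) :
    ∑ m : Fin n, star (zeta n ^ (m.1 * p.1)) * zeta n ^ (m.1 * q.1) =
      if p = q then (n : ℂ) else 0 := by
  split_ifs with h
  · subst h
    simp only [star_zeta_mul, Finset.sum_const, Finset.card_univ, Fintype.card_fin,
      nsmul_eq_mul, mul_one]
  · set r := q - p with hr
    have hq : q = r + p := by simp [hr]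
    have hr0 : r.1 ≠ 0 := fun h0 => h (sub_eq_zero.1 (Fin.ext h0 : r = 0)).symm
    have : ∀ m : Fin n, star (zeta n ^ (m.1 * p.1)) * zeta n ^ (m.1 * q.1)
        = (zeta n ^ r.1) ^ m.1 := by
      intro m
      rw [hq, zeta_pow_add, mul_comm (zeta n ^ _), ← mul_assoc, star_zeta_mul, one_mul, mul_comm,
        pow_mul]
    simp only [this]
    rw [Fin.sum_univ_eq_sum_range (fun m => (zeta n ^ r.1) ^ m) n]
    have h1 : zeta n ^ r.1 ≠ 1 := zeta_primitive.pow_ne_one_of_pos_of_lt hr0 r.2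
    rw [geom_sum_eq h1, ← pow_mul, mul_comm, pow_mul, zeta_primitive.pow_eq_one]
    simp

lemma Fq_conjTranspose_mul {μ : Quaternion ℝ} (h : UnitPure μ) : (Fq μ n)ᴴ * Fq μ n = 1 := by
  ext1 p q
  have : ∀ m : Fin n, star (Fq μ n m p) * Fq μ n m q = ((1 / n : ℝ) : Quaternion ℝ) *
      cEmb h (star (zeta n ^ (m.1 * p.1)) * zeta n ^ (m.1 * q.1)) := by
    intro m
    rw [Fq_apply h, Fq_apply h, star_mul, Quaternion.star_coe, map_mul, cEmb_star,
      ← coe_sqrt_mul_self]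
    simp only [Quaternion.coe_mul_eq_smul, Quaternion.mul_coe_eq_smul, smul_mul_assoc,
      mul_smul_comm]
  simp only [mul_apply, conjTranspose_apply, this]
  rw [← Finset.mul_sum, ← map_sum, zeta_sum, one_apply]
  split_ifs
  · rw [map_natCast, ← Quaternion.coe_natCast, ← Quaternion.coe_mul, one_div,
      inv_mul_cancel₀ (Nat.cast_ne_zero.2 (NeZero.ne n)), Quaternion.coe_one]
  · simp

lemma Fq_mul_conjTranspose {μ : Quaternion ℝ} (h : UnitPure μ) : Fq μ n * (Fq μ n)ᴴ = 1 := by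
  ext1 p q
  have h1 := congrFun (congrFun (Fq_conjTranspose_mul (n := n) h) q) p
  have hc : ∀ m : Fin n, Fq μ n p m * star (Fq μ n q m) = star (Fq μ n m q) * Fq μ n m p := by
    intro m
    rw [Fq_apply h, Fq_apply h, Fq_apply h, Fq_apply h, star_mul, star_mul, Quaternion.star_coe,
      ← cEmb_star, ← cEmb_star, mul_comm p.1, mul_comm q.1]
    simp only [Quaternion.coe_mul_eq_smul, Quaternion.mul_coe_eq_smul, smul_mul_assoc,
      mul_smul_comm, ← map_mul]
    rw [mul_comm (star _)]
  simp only [mul_apply, conjTranspose_apply] at h1 ⊢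
  simp only [hc, h1, one_apply, eq_comm]

/-- The circulant matrix of a real vector. -/
def circVec (a : Fin n → ℝ) : Matrix (Fin n) (Fin n) (Quaternion ℝ) :=
  fun l m => ((a (l - m) : ℝ) : Quaternion ℝ)

lemma dft_apply {μ : Quaternion ℝ} (h : UnitPure μ) (v : Fin n → Quaternion ℝ) (l : Fin n) :
    dft μ v l = ∑ m, cEmb h (zeta n ^ (l.1 * m.1)) * v m := by
  have h0 : Real.sqrt n ≠ 0 := (Real.sqrt_pos.2 (Nat.cast_pos.2 (NeZero.pos n))).ne'
  simp only [dft, Pi.smul_apply, smul_eq_mul, mulVec, dotProduct, Finset.mul_sum, Fq_apply h]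
  refine Finset.sum_congr rfl fun m _ => ?_
  rw [← mul_assoc, ← mul_assoc, ← Quaternion.coe_mul, mul_one_div_cancel h0]
  simp

lemma Fq_mul_circVec {μ : Quaternion ℝ} (h : UnitPure μ) (a : Fin n → ℝ) :
    Fq μ n * circVec a = diagonal (dft μ fun m => (a m : Quaternion ℝ)) * Fq μ n := by
  ext1 l q
  rw [diagonal_mul, dft_apply h, mul_apply, Finset.sum_mul, ← Equiv.sum_comp (Equiv.addRight q)]
  refine Finset.sum_congr rfl fun m _ => ?_
  simp only [Equiv.coe_addRight, circVec, add_sub_cancel_right, Fq_apply h, zeta_pow_add, map_mul]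
  simp only [Quaternion.coe_mul_eq_smul, Quaternion.mul_coe_eq_smul, smul_mul_assoc,
      mul_smul_comm]

/-- The QDFT turns one component of the gQt-product into a pointwise product. -/
lemma dft_component {μ ν u : Quaternion ℝ} (hν : UnitPure ν)
    (huν : μ * u = u * ν) (a : Fin n → ℝ) (b : Fin n → Quaternion ℝ) :
    dft μ ((u • (circVec a * Tm ν μ n)) *ᵥ b)
      = dft μ (fun m => u * (a m : Quaternion ℝ)) * dft μ b := by
  have h1 : dft μ (fun m => u * (a m : Quaternion ℝ))
      = u • dft ν (fun m => (a m : Quaternion ℝ)) := by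
    rw [show (fun m => u * (a m : Quaternion ℝ)) = u • fun m => (a m : Quaternion ℝ) from rfl,
      dft, mulVec_unit_smul huν, dft]
    ext1 l
    simp only [Pi.smul_apply, smul_eq_mul]
    rw [← mul_assoc, ← mul_assoc, Quaternion.coe_commutes]
  rw [h1, smul_mulVec]
  nth_rw 1 [dft]
  rw [ mulVec_unit_smul huν, Tm, mulVec_mulVec, ← Matrix.mul_assoc,
    Fq_mul_circVec hν, Matrix.mul_assoc (diagonal _), ← Matrix.mul_assoc (Fq ν n),
    Fq_mul_conjTranspose hν, Matrix.one_mul, ← mulVec_mulVec]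
  rw [show dft μ b = ((Real.sqrt n : ℝ) : Quaternion ℝ) • (Fq μ n *ᵥ b) from rfl]
  ext1 l
  simp only [Pi.smul_apply, smul_eq_mul, mulVec_diagonal, Pi.mul_apply]
  simp only [Quaternion.coe_mul_eq_smul, mul_smul_comm, mul_assoc]

end Fourier

section Units

open scoped Quaternion

lemma unitPure_iff {μ : Quaternion ℝ} :
    UnitPure μ ↔ μ.re = 0 ∧ μ.imI ^ 2 + μ.imJ ^ 2 + μ.imK ^ 2 = 1 := by
  refine and_congr_right fun h => ?_
  rw [← sq_eq_sq₀ (norm_nonneg μ) zero_le_one, sq, ← Quaternion.normSq_eq_norm_mul_self,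
    Quaternion.normSq_def', h]
  simp

lemma UnitPure.mui {μ : Quaternion ℝ} (h : UnitPure μ) : UnitPure (mui μ) := by
  rw [unitPure_iff] at h ⊢
  simpa [QTpaper.mui] using h.2

lemma UnitPure.muj {μ : Quaternion ℝ} (h : UnitPure μ) : UnitPure (muj μ) := by
  rw [unitPure_iff] at h ⊢
  simpa [QTpaper.muj] using h.2

lemma UnitPure.muk {μ : Quaternion ℝ} (h : UnitPure μ) : UnitPure (muk μ) := by
  rw [unitPure_iff] at h ⊢
  simpa [QTpaper.muk] using h.2

lemma UnitPure.mul_qi {μ : Quaternion ℝ} (h : UnitPure μ) : μ * qi = qi * QTpaper.mui μ := by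
  ext <;> simp only [Quaternion.re_mul, Quaternion.imI_mul, Quaternion.imJ_mul,
      Quaternion.imK_mul] <;>
    simp [qi, QTpaper.mui, h.1]

lemma UnitPure.mul_qj {μ : Quaternion ℝ} (h : UnitPure μ) : μ * qj = qj * QTpaper.muj μ := by
  ext <;> simp only [Quaternion.re_mul, Quaternion.imI_mul, Quaternion.imJ_mul,
      Quaternion.imK_mul] <;>
    simp [qj, QTpaper.muj, h.1]

lemma UnitPure.mul_qk {μ : Quaternion ℝ} (h : UnitPure μ) : μ * qk = qk * QTpaper.muk μ := by
  ext <;> simp only [Quaternion.re_mul, Quaternion.imI_mul, Quaternion.imJ_mul,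
      Quaternion.imK_mul] <;>
    simp [qk, QTpaper.muk, h.1]

lemma star_qi : star qi = -qi := Quaternion.star_eq_neg.2 rfl

lemma star_qj : star qj = -qj := Quaternion.star_eq_neg.2 rfl

lemma star_qk : star qk = -qk := Quaternion.star_eq_neg.2 rfl

lemma eq_components (x : Quaternion ℝ) :
    x = 1 * (x.re : Quaternion ℝ) + qi * (x.imI : Quaternion ℝ) + qj * (x.imJ : Quaternion ℝ)
      + qk * (x.imK : Quaternion ℝ) := by
  ext <;> simp only [Quaternion.re_add, Quaternion.imI_add, Quaternion.imJ_add, Quaternion.imK_add,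
    Quaternion.re_mul, Quaternion.imI_mul, Quaternion.imJ_mul,
      Quaternion.imK_mul] <;>
    simp [qi, qj, qk]

end Units

section Tensor

open scoped Quaternion

variable {n₁ n₂ r n : ℕ}

lemma fftT_eq_dft (μ : Quaternion ℝ) (A : QTensor n₁ n₂ n) (p : Fin n₁) (q : Fin n₂) :
    fftT μ A p q = dft μ (A p q) := rfl

lemma frobT_nonneg (A : QTensor n₁ n₂ n) : 0 ≤ frobT A := Real.sqrt_nonneg _

lemma circ_mul_kronecker (A : QTensor n₁ r n) (T : Matrix (Fin n) (Fin n) (Quaternion ℝ))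
    (l m : Fin n) (p : Fin n₁) (s : Fin r) :
    (circ A * (T ⊗ₖ (1 : Matrix (Fin r) (Fin r) (Quaternion ℝ)))) (l, p) (m, s)
      = ∑ m', A p s (l - m') * T m' m := by
  simp [mul_apply, Fintype.sum_prod_type, kroneckerMap_apply, circ, one_apply]

variable [NeZero n]

lemma gQt_eq_sum_mulVec (μ : Quaternion ℝ) (hμ : UnitPure μ) (A : QTensor n₁ r n)
    (B : QTensor r n₂ n) (p : Fin n₁) (q : Fin n₂) :
    gQt μ A B p q = ∑ s,
      ((((1 : Quaternion ℝ) • (circVec (fun m => (A p s m).re) * Tm μ μ n)) *ᵥ B s q)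
        + ((qi • (circVec (fun m => (A p s m).imI) * Tm (mui μ) μ n)) *ᵥ B s q)
        + ((qj • (circVec (fun m => (A p s m).imJ) * Tm (muj μ) μ n)) *ᵥ B s q)
        + ((qk • (circVec (fun m => (A p s m).imK) * Tm (muk μ) μ n)) *ᵥ B s q)) := by
  ext1 l
  simp only [← add_mulVec]
  rw [show Tm μ μ n = 1 from Fq_conjTranspose_mul hμ]
  simp only [Matrix.mul_one]
  simp only [gQt, fold3, mul_apply, Fintype.sum_prod_type, Finset.sum_apply]
  rw [Finset.sum_comm]
  refine Finset.sum_congr rfl fun s _ => ?_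
  simp only [mulVec, dotProduct]
  refine Finset.sum_congr rfl fun m _ => ?_
  simp only [Matrix.add_apply, Matrix.smul_apply, circ_mul_kronecker, unfold3, one_smul]
  rfl

lemma fslice_fftT_gQt {μ : Quaternion ℝ} (hμ : UnitPure μ) (A : QTensor n₁ r n)
    (B : QTensor r n₂ n) (l : Fin n) :
    fslice (fftT μ (gQt μ A B)) l = fslice (fftT μ A) l * fslice (fftT μ B) l := by
  ext1 p q
  simp only [fslice, mul_apply, fftT_eq_dft]
  rw [gQt_eq_sum_mulVec μ hμ, dft_sum, Finset.sum_apply]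
  refine Finset.sum_congr rfl fun s _ => ?_
  rw [dft_add, dft_add, dft_add, dft_component hμ (by simp), dft_component hμ.mui hμ.mul_qi,
    dft_component hμ.muj hμ.mul_qj, dft_component hμ.muk hμ.mul_qk, ← add_mul, ← add_mul, ← add_mul,
    ← dft_add, ← dft_add, ← dft_add, Pi.mul_apply]
  congr 3
  ext1 m
  exact (eq_components _).symm

lemma val_revIdx_eq_neg (m : Fin n) : revIdx m = -m := by
  ext1
  rw [revIdx, Fin.val_neg]
  by_cases h : m = 0
  · simp [h]
  · have h' : m.1 ≠ 0 := fun h0 => h (Fin.ext h0)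
    simp [h, h']

lemma zeta_pow_neg (l m : Fin n) : zeta n ^ (l.1 * (-m).1) = star (zeta n ^ (l.1 * m.1)) := by
  have h1 : zeta n ^ (l.1 * (-m).1) * zeta n ^ (l.1 * m.1) = 1 := by
    rw [← zeta_pow_add]; simp
  have h2 := star_zeta_mul n (l.1 * m.1)
  exact mul_right_cancel₀ (right_ne_zero_of_mul_eq_one h1) (h1.trans h2.symm)

lemma dft_real_rev {ν : Quaternion ℝ} (hν : UnitPure ν) (a : Fin n → ℝ) (l : Fin n) :
    dft ν (fun m => (a (revIdx m) : Quaternion ℝ)) l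
      = star (dft ν (fun m => (a m : Quaternion ℝ)) l) := by
  rw [dft_apply hν, dft_apply hν, star_sum, ← Equiv.sum_comp (Equiv.neg (Fin n))]
  refine Finset.sum_congr rfl fun m _ => ?_
  rw [Equiv.neg_apply, val_revIdx_eq_neg, neg_neg, zeta_pow_neg, star_mul, cEmb_star,
    Quaternion.star_coe, Quaternion.coe_commutes]

lemma dft_conjTranspose_component {μ ν u : Quaternion ℝ} (hμ : UnitPure μ) (hν : UnitPure ν)
    (huν : μ * u = u * ν) (hu : star u = -u) (a : Fin n → ℝ) (l : Fin n) :
    dft μ (fun m => ((Tm ν μ n)ᴴ *ᵥ fun m => (a (revIdx m) : Quaternion ℝ)) m * u) l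
      = -star (dft μ (fun m => u * (a m : Quaternion ℝ)) l) := by
  have h1 : dft μ (fun m => u * (a m : Quaternion ℝ))
      = u • dft ν (fun m => (a m : Quaternion ℝ)) := by
    rw [show (fun m => u * (a m : Quaternion ℝ)) = u • fun m => (a m : Quaternion ℝ) from rfl,
      dft, mulVec_unit_smul huν, dft]
    ext1 l
    simp only [Pi.smul_apply, smul_eq_mul]
    rw [← mul_assoc, ← mul_assoc, Quaternion.coe_commutes]
  have h2 : ∀ v : Fin n → Quaternion ℝ, dft μ (fun m => v m * u) l = dft μ v l * u := by
    intro v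
    rw [dft_apply hμ, dft_apply hμ, Finset.sum_mul]
    simp only [mul_assoc]
  rw [h2, h1, Pi.smul_apply, smul_eq_mul, star_mul, hu, mul_neg, neg_neg, ← dft_real_rev hν, dft,
    Tm, conjTranspose_mul, conjTranspose_conjTranspose, mulVec_mulVec, ← Matrix.mul_assoc,
    Fq_mul_conjTranspose hμ, Matrix.one_mul, dft]

lemma fslice_fftT_conjT {μ : Quaternion ℝ} (hμ : UnitPure μ) (A : QTensor n₁ n₂ n) (l : Fin n) :
    fslice (fftT μ (conjT μ A)) l = (fslice (fftT μ A) l)ᴴ := by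
  ext1 q p
  simp only [fslice, conjTranspose_apply, fftT_eq_dft]
  have hk : ∀ (T : Matrix (Fin n) (Fin n) (Quaternion ℝ)) (B : QTensor n₂ n₁ n) (m : Fin n),
      (T ⊗ₖ (1 : Matrix (Fin n₂) (Fin n₂) (Quaternion ℝ)) * unfold3 B) (m, q) p
        = (T *ᵥ B q p) m := by
    intro T B m
    simp [mul_apply, Fintype.sum_prod_type, kroneckerMap_apply, one_apply, unfold3, mulVec,
      dotProduct]
  have h1 : conjT μ A q p = (fun m => (((A p q (revIdx m)).re : ℝ) : Quaternion ℝ))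
      - (fun m => ((Tm (mui μ) μ n)ᴴ *ᵥ fun m => ((A p q (revIdx m)).imI : Quaternion ℝ)) m * qi)
      - (fun m => ((Tm (muj μ) μ n)ᴴ *ᵥ fun m => ((A p q (revIdx m)).imJ : Quaternion ℝ)) m * qj)
      - (fun m =>
          ((Tm (muk μ) μ n)ᴴ *ᵥ fun m => ((A p q (revIdx m)).imK : Quaternion ℝ)) m * qk) := by
    ext1 m
    simp only [conjT, fold3, Matrix.sub_apply, rmulM, hk]
    rfl
  have h2 : A p q = (fun m => ((A p q m).re : Quaternion ℝ))
      + (fun m => qi * ((A p q m).imI : Quaternion ℝ))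
      + (fun m => qj * ((A p q m).imJ : Quaternion ℝ))
      + (fun m => qk * ((A p q m).imK : Quaternion ℝ)) := by
    ext1 m
    simpa using eq_components (A p q m)
  rw [h1]
  conv_rhs => rw [h2]
  simp only [dft_sub, dft_add, Pi.sub_apply, Pi.add_apply, star_add]
  rw [dft_real_rev hμ fun m => (A p q m).re,
    dft_conjTranspose_component hμ hμ.mui hμ.mul_qi star_qi fun m => (A p q m).imI,
    dft_conjTranspose_component hμ hμ.muj hμ.mul_qj star_qj fun m => (A p q m).imJ,
    dft_conjTranspose_component hμ hμ.muk hμ.mul_qk star_qk fun m => (A p q m).imK]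
  abel

lemma fslice_fftT_idT {μ : Quaternion ℝ} (hμ : UnitPure μ) (l : Fin n) :
    fslice (fftT μ (idT n₁ n)) l = 1 := by
  ext1 p q
  rw [fslice, fftT_eq_dft, dft_apply hμ, Finset.sum_eq_single 0]
  · simp [idT, one_apply]
  · intro m _ hm
    simp [idT, hm]
  · simp

lemma fslice_fftT_sub {n : ℕ} (μ : Quaternion ℝ) (A B : QTensor n₁ n₂ n) (l : Fin n) :
    fslice (fftT μ (A - B)) l = fslice (fftT μ A) l - fslice (fftT μ B) l := by
  ext1 p q
  exact congrFun (dft_sub μ (A p q) (B p q)) l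

lemma fslice_fftT_sum {n : ℕ} {ι : Type*} (s : Finset ι) (μ : Quaternion ℝ)
    (A : ι → QTensor n₁ n₂ n)
    (l : Fin n) :
    fslice (fftT μ (∑ i ∈ s, A i)) l = ∑ i ∈ s, fslice (fftT μ (A i)) l := by
  ext1 p q
  rw [Matrix.sum_apply, fslice, fftT_eq_dft, Finset.sum_apply, Finset.sum_apply, dft_sum,
    Finset.sum_apply]
  rfl

/-- Parseval's identity for the QDFT. -/
lemma sum_frobSq_fslice_fftT {μ : Quaternion ℝ} (hμ : UnitPure μ) (A : QTensor n₁ n₂ n) :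
    ∑ l, frobSq (fslice (fftT μ A) l) = n * frobT A ^ 2 := by
  have h1 := frobSq_isometry_mul (Fq_conjTranspose_mul (n := n) hμ)
    (fun m (pq : Fin n₁ × Fin n₂) => A pq.1 pq.2 m)
  have h2 : frobT A ^ 2 = frobSq (fun m (pq : Fin n₁ × Fin n₂) => A pq.1 pq.2 m) := by
    rw [frobT, Real.sq_sqrt (by positivity)]
    unfold frobSq
    simp only [Fintype.sum_prod_type]
    rw [Finset.sum_comm]
    simp only [Finset.sum_comm (s := (Finset.univ : Finset (Fin n)))]
    rw [Finset.sum_comm]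
  have h3 : ∀ x : Quaternion ℝ, ‖((Real.sqrt n : ℝ) : Quaternion ℝ) * x‖ ^ 2 = n * ‖x‖ ^ 2 := by
    intro x
    rw [norm_mul, mul_pow, Quaternion.norm_coe, Real.norm_eq_abs, sq_abs,
      Real.sq_sqrt (Nat.cast_nonneg n)]
  rw [h2, ← h1]
  unfold frobSq
  rw [Finset.mul_sum]
  refine Finset.sum_congr rfl fun l _ => ?_
  rw [Fintype.sum_prod_type, Finset.mul_sum]
  refine Finset.sum_congr rfl fun p _ => ?_
  rw [Finset.mul_sum]
  exact Finset.sum_congr rfl fun q _ => h3 _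

lemma unitaryT.fslice_fftT {μ : Quaternion ℝ} (hμ : UnitPure μ) {U : QTensor n₁ n₁ n}
    (hU : unitaryT μ U) (l : Fin n) :
    (fslice (fftT μ U) l)ᴴ * fslice (fftT μ U) l = 1 ∧
      fslice (fftT μ U) l * (fslice (fftT μ U) l)ᴴ = 1 := by
  rw [← fslice_fftT_conjT hμ, ← fslice_fftT_gQt hμ, ← fslice_fftT_gQt hμ, hU.1, hU.2,
    fslice_fftT_idT hμ]
  exact ⟨rfl, rfl⟩

end Tensor

section DiagonalMatrix

open scoped Quaternion

variable {n₁ n₂ : ℕ} {D : Matrix (Fin n₁) (Fin n₂) (Quaternion ℝ)}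

lemma mul_conjTranspose_apply_of_diag (hD : ∀ p q, p.1 ≠ q.1 → D p q = 0) {p p' : Fin n₁}
    (h : p ≠ p') : (D * Dᴴ) p p' = 0 := by
  rw [mul_apply]
  refine Finset.sum_eq_zero fun q _ => ?_
  by_cases hq : p.1 = q.1
  · rw [conjTranspose_apply, hD p' q fun h' => h (Fin.ext (hq.trans h'.symm)), star_zero, mul_zero]
  · rw [hD p q hq, zero_mul]

lemma antitone_row_norms (hD : ∀ p q, p.1 ≠ q.1 → D p q = 0)
    (hreal : ∀ p q, (D p q).imI = 0 ∧ (D p q).imJ = 0 ∧ (D p q).imK = 0)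
    (hpos : ∀ p q, 0 ≤ (D p q).re)
    (hmono : ∀ p p' q q', p.1 = q.1 → p'.1 = q'.1 → p.1 ≤ p'.1 → (D p' q').re ≤ (D p q).re) :
    Antitone fun p => ∑ q, ‖D p q‖ ^ 2 := by
  have hnorm : ∀ p q, ‖D p q‖ ^ 2 = (D p q).re ^ 2 := by
    intro p q
    obtain ⟨h1, h2, h3⟩ := hreal p q
    rw [sq ‖_‖, ← Quaternion.normSq_eq_norm_mul_self, Quaternion.normSq_def', h1, h2, h3]
    ring
  have hrow : ∀ p (hp : p.1 < n₂), ∑ q, ‖D p q‖ ^ 2 = (D p ⟨p.1, hp⟩).re ^ 2 := by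
    intro p hp
    rw [Finset.sum_eq_single ⟨p.1, hp⟩, hnorm]
    · intro q _ hq
      rw [hD p q fun h => hq (Fin.ext h.symm)]
      simp
    · simp
  intro p p' hpp
  dsimp only
  by_cases hp' : p'.1 < n₂
  · rw [hrow p' hp', hrow p (lt_of_le_of_lt hpp hp')]
    exact pow_le_pow_left₀ (hpos _ _) (hmono _ _ _ _ rfl rfl hpp) 2
  · rw [Finset.sum_eq_zero fun q _ => by rw [hD p' q (by omega)]; simp]
    positivity

lemma sum_rank_one_eq_truncation {n₁ n₂ k : ℕ} (hk₁ : k ≤ n₁) (hk₂ : k ≤ n₂)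
    {D : Matrix (Fin n₁) (Fin n₂) (Quaternion ℝ)} (hD : ∀ p q, p.1 ≠ q.1 → D p q = 0)
    (U : Matrix (Fin n₁) (Fin n₁) (Quaternion ℝ)) (V : Matrix (Fin n₂) (Fin n₂) (Quaternion ℝ)) :
    ∑ i : Fin k,
        (of fun p _ => U p (i.castLE hk₁) : Matrix (Fin n₁) (Fin 1) (Quaternion ℝ))
        * (of fun _ _ => D (i.castLE hk₁) (i.castLE hk₂) : Matrix (Fin 1) (Fin 1) (Quaternion ℝ))
        * (of fun p _ => V p (i.castLE hk₂) : Matrix (Fin n₂) (Fin 1) (Quaternion ℝ))ᴴ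
      = U * ((of fun p q => if p.1 < k then D p q else 0) * Vᴴ) := by
  ext1 p q
  rw [Matrix.sum_apply, mul_apply]
  refine Finset.sum_of_injOn (Fin.castLE hk₁) (Fin.castLE_injective hk₁).injOn
    (fun _ _ => Finset.mem_coe.2 (Finset.mem_univ _)) ?_ ?_
  · intro x _ hx
    have hxk : ¬ x.1 < k := fun h => hx ⟨⟨x.1, h⟩, by simp, rfl⟩
    simp [mul_apply, hxk]
  · intro i _
    have hr : ((of fun p q => if p.1 < k then D p q else 0) * Vᴴ) (i.castLE hk₁) q
        = D (i.castLE hk₁) (i.castLE hk₂) * star (V q (i.castLE hk₂)) := by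
      rw [mul_apply, Finset.sum_eq_single (i.castLE hk₂)]
      · simp
      · intro j _ hj
        simp [hD (i.castLE hk₁) j fun h => hj (Fin.ext h.symm)]
      · simp
    rw [hr]
    simp [mul_apply, mul_assoc]

end DiagonalMatrix

/-- the truncated gQt-SVD is a best gQt-rank-`k` approximation. -/
theorem gQt_svd_best_rank_k {n₁ n₂ n₃ : ℕ} (μ : Quaternion ℝ) (hμ : UnitPure μ)
    (A : QTensor n₁ n₂ n₃)
    (U : QTensor n₁ n₁ n₃) (S : QTensor n₁ n₂ n₃) (V : QTensor n₂ n₂ n₃)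
    (hU : unitaryT μ U) (hV : unitaryT μ V) (hS : fDiag S)
    (hA : A = gQt μ U (gQt μ S (conjT μ V)))
    (hSreal : ∀ (l : Fin n₃) (p : Fin n₁) (q : Fin n₂),
        (fftT μ S p q l).imI = 0 ∧ (fftT μ S p q l).imJ = 0 ∧ (fftT μ S p q l).imK = 0)
    (hSpos : ∀ (l : Fin n₃) (p : Fin n₁) (q : Fin n₂), 0 ≤ (fftT μ S p q l).re)
    (hSdiag : ∀ (l : Fin n₃) (p : Fin n₁) (q : Fin n₂), p.1 ≠ q.1 → fftT μ S p q l = 0)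
    (hSmono : ∀ (l : Fin n₃) (p p' : Fin n₁) (q q' : Fin n₂),
        p.1 = q.1 → p'.1 = q'.1 → p.1 ≤ p'.1 →
        (fftT μ S p' q' l).re ≤ (fftT μ S p q l).re)
    (k : ℕ) (hk : k < min n₁ n₂) :
    ∀ (X : QTensor n₁ k n₃) (Y : QTensor k n₂ n₃),
      frobT (A - ∑ i : Fin k,
          gQt μ
            (gQt μ
              (fun p (_ : Fin 1) l => U p ⟨i.1, (i.2.trans hk).trans_le (min_le_left n₁ n₂)⟩ l)
              (fun (_ : Fin 1) (_ : Fin 1) l =>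
                S ⟨i.1, (i.2.trans hk).trans_le (min_le_left n₁ n₂)⟩
                  ⟨i.1, (i.2.trans hk).trans_le (min_le_right n₁ n₂)⟩ l))
            (conjT μ (fun p (_ : Fin 1) l =>
              V p ⟨i.1, (i.2.trans hk).trans_le (min_le_right n₁ n₂)⟩ l)))
        ≤ frobT (A - gQt μ X Y) := by
  intro X Y
  obtain rfl | hn := Nat.eq_zero_or_pos n₃
  · simp [frobT]
  have : NeZero n₃ := ⟨hn.ne'⟩
  have hk₁ : k < n₁ := hk.trans_le (min_le_left n₁ n₂)
  have hk₂ : k < n₂ := hk.trans_le (min_le_right n₁ n₂)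
  refine (sq_le_sq₀ (frobT_nonneg _) (frobT_nonneg _)).1 ?_
  refine le_of_mul_le_mul_left ?_ (Nat.cast_pos.2 hn : (0 : ℝ) < n₃)
  rw [← sum_frobSq_fslice_fftT hμ, ← sum_frobSq_fslice_fftT hμ]
  refine Finset.sum_le_sum fun l _ => ?_
  obtain ⟨hU₁, hU₂⟩ := hU.fslice_fftT hμ l
  obtain ⟨hV₁, hV₂⟩ := hV.fslice_fftT hμ l
  have hAl : fslice (fftT μ A) l
      = fslice (fftT μ U) l * (fslice (fftT μ S) l * (fslice (fftT μ V) l)ᴴ) := by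
    rw [hA, fslice_fftT_gQt hμ, fslice_fftT_gQt hμ, fslice_fftT_conjT hμ]
  rw [fslice_fftT_sub, fslice_fftT_sub, fslice_fftT_sum, fslice_fftT_gQt hμ, hAl]
  simp only [fslice_fftT_gQt hμ, fslice_fftT_conjT hμ]
  set D := fslice (fftT μ S) l with hDdef
  set U' := fslice (fftT μ U) l with hU'
  set V' := fslice (fftT μ V) l with hV'
  have hdiag : ∀ p q, p.1 ≠ q.1 → D p q = 0 := hSdiag l
  have htrunc := sum_rank_one_eq_truncation hk₁.le hk₂.le hdiag U' V'
  have hXY : fslice (fftT μ X) l * fslice (fftT μ Y) l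
      = U' * ((U'ᴴ * fslice (fftT μ X) l) * (fslice (fftT μ Y) l * V') * V'ᴴ) := by
    rw [Matrix.mul_assoc (U'ᴴ * _), Matrix.mul_assoc (fslice (fftT μ Y) l), hV₂, Matrix.mul_one,
      Matrix.mul_assoc, ← Matrix.mul_assoc U', hU₂, Matrix.one_mul]
  rw [hXY, ← Matrix.mul_sub, ← Matrix.sub_mul, frobSq_isometry_mul hU₁,
    frobSq_mul_conjTranspose_isometry hV₁]
  refine (le_of_eq ?_).trans (frobSq_truncation_le hk₁ D
    (fun _ _ => mul_conjTranspose_apply_of_diag hdiag)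
    (antitone_row_norms hdiag (hSreal l) (hSpos l) (hSmono l)) _ _)
  refine (congrArg (fun M => frobSq (U' * (D * V'ᴴ) - M)) htrunc).trans ?_
  rw [← Matrix.mul_sub, ← Matrix.sub_mul, frobSq_isometry_mul hU₁,
    frobSq_mul_conjTranspose_isometry hV₁]
  congr 1
  ext1 p q
  rw [Matrix.sub_apply]
  by_cases hp : p.1 < k <;> simp [hp]

end QTpaper
end
end

section
/- Let B ∈ ℍ^{r×n₂}, C ∈ ℍ^{n₁×n₂}, A₀ ∈ ℍ^{n₁×r}, and λ, β ≥ 0 with λ + β > 0. Then the quaternion matrix B B* + (λ+β) I_r is invertible, and A⁺ = (C B* + β A₀)(B B* + (λ+β) I_r)^{-1} is the unique minimizer over A ∈ ℍ^{n₁×r} of the function g(A) = ½‖A B − C‖_F² + (λ/2)‖A‖_F² + (β/2)‖A − A₀‖_F². -/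
noncomputable section
open Matrix Kronecker Filter Topology

namespace QTpaper

/-- The regularized least-squares objective. -/
def lsObj {n₁ n₂ r : ℕ} (B : Matrix (Fin r) (Fin n₂) (Quaternion ℝ))
    (C : Matrix (Fin n₁) (Fin n₂) (Quaternion ℝ)) (A₀ : Matrix (Fin n₁) (Fin r) (Quaternion ℝ))
    (lam beta : ℝ) (A : Matrix (Fin n₁) (Fin r) (Quaternion ℝ)) : ℝ :=
  (1 / 2) * frobM (A * B - C) ^ 2 + (lam / 2) * frobM A ^ 2
    + (beta / 2) * frobM (A - A₀) ^ 2

/-- The real inner product on quaternion matrices inducing the Frobenius norm. -/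
def frobInner {m n : ℕ} (X Y : Matrix (Fin m) (Fin n) (Quaternion ℝ)) : ℝ :=
  (X * Yᴴ).trace.re

theorem frobInner_add_left {m n : ℕ} (X Y Z : Matrix (Fin m) (Fin n) (Quaternion ℝ)) :
    frobInner (X + Y) Z = frobInner X Z + frobInner Y Z := by
  simp [frobInner, Matrix.add_mul]

theorem frobInner_sub_left {m n : ℕ} (X Y Z : Matrix (Fin m) (Fin n) (Quaternion ℝ)) :
    frobInner (X - Y) Z = frobInner X Z - frobInner Y Z := by
  simp [frobInner, Matrix.sub_mul]

theorem frobInner_smul_left {m n : ℕ} (c : ℝ) (X Y : Matrix (Fin m) (Fin n) (Quaternion ℝ)) :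
    frobInner (c • X) Y = c * frobInner X Y := by
  simp [frobInner, Matrix.smul_mul, Matrix.trace_smul]

theorem frobInner_comm {m n : ℕ} (X Y : Matrix (Fin m) (Fin n) (Quaternion ℝ)) :
    frobInner X Y = frobInner Y X := by
  have h : (X * Yᴴ)ᴴ = Y * Xᴴ := by
    rw [Matrix.conjTranspose_mul, Matrix.conjTranspose_conjTranspose]
  rw [frobInner, frobInner, ← h, Matrix.trace_conjTranspose, Quaternion.re_star]

theorem frobInner_mul_left {m n r : ℕ} (X : Matrix (Fin m) (Fin r) (Quaternion ℝ))
    (B : Matrix (Fin r) (Fin n) (Quaternion ℝ)) (Y : Matrix (Fin m) (Fin n) (Quaternion ℝ)) :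
    frobInner Y (X * B) = frobInner (Y * Bᴴ) X := by
  rw [frobInner, frobInner, Matrix.conjTranspose_mul, Matrix.mul_assoc]

theorem frobInner_self {m n : ℕ} (X : Matrix (Fin m) (Fin n) (Quaternion ℝ)) :
    frobInner X X = ∑ p, ∑ q, ‖X p q‖ ^ 2 := by
  have h : ∀ x : Quaternion ℝ, x * star x = ((‖x‖ ^ 2 : ℝ) : Quaternion ℝ) := fun x => by
    rw [Quaternion.self_mul_star, Quaternion.normSq_eq_norm_mul_self, sq]
  have hc : ∀ x : ℝ, (x : Quaternion ℝ) = algebraMap ℝ (Quaternion ℝ) x := fun _ => rfl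
  simp only [frobInner, Matrix.trace, Matrix.diag, Matrix.mul_apply, Matrix.conjTranspose_apply, h,
    hc, ← map_sum]
  exact Quaternion.re_coe _

theorem frobM_sq {m n : ℕ} (X : Matrix (Fin m) (Fin n) (Quaternion ℝ)) :
    frobM X ^ 2 = frobInner X X := by
  rw [frobM, frobInner_self, Real.sq_sqrt (by positivity)]

theorem frobInner_self_nonneg {m n : ℕ} (X : Matrix (Fin m) (Fin n) (Quaternion ℝ)) :
    0 ≤ frobInner X X :=
  frobM_sq X ▸ sq_nonneg _

theorem frobInner_self_eq_zero {m n : ℕ} {X : Matrix (Fin m) (Fin n) (Quaternion ℝ)}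
    (h : frobInner X X = 0) : X = 0 := by
  rw [frobInner_self, Finset.sum_eq_zero_iff_of_nonneg fun _ _ => by positivity] at h
  ext1 p q
  have hp := h p (Finset.mem_univ p)
  rw [Finset.sum_eq_zero_iff_of_nonneg fun _ _ => by positivity] at hp
  simpa using hp q (Finset.mem_univ q)

theorem frobM_add_sq {m n : ℕ} (X Y : Matrix (Fin m) (Fin n) (Quaternion ℝ)) :
    frobM (X + Y) ^ 2 = frobM X ^ 2 + 2 * frobInner X Y + frobM Y ^ 2 := by
  rw [frobM_sq, frobM_sq, frobM_sq, frobInner_add_left, frobInner_comm X, frobInner_comm Y (X + Y),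
    frobInner_add_left, frobInner_add_left, frobInner_comm Y X]
  ring

theorem isUnit_mul_conjTranspose_add_smul_one {n r : ℕ}
    (B : Matrix (Fin r) (Fin n) (Quaternion ℝ)) {c : ℝ} (hc : 0 < c) :
    IsUnit (B * Bᴴ + c • (1 : Matrix (Fin r) (Fin r) (Quaternion ℝ))) := by
  set M := B * Bᴴ + c • (1 : Matrix (Fin r) (Fin r) (Quaternion ℝ)) with hM
  have hMM : Mᴴ = M := by
    have h1 : (c • (1 : Matrix (Fin r) (Fin r) (Quaternion ℝ)))ᴴ = c • 1 := by
      ext1 p q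
      by_cases hpq : p = q <;> simp [hpq, eq_comm]
    rw [hM, Matrix.conjTranspose_add, Matrix.conjTranspose_mul, Matrix.conjTranspose_conjTranspose,
      h1]
  have hinj : Function.Injective (LinearMap.mulRight ℝ M) := by
    rw [← LinearMap.ker_eq_bot, LinearMap.ker_eq_bot']
    intro X hX
    rw [LinearMap.mulRight_apply] at hX
    have h : frobInner (X * M) X = frobInner (X * B) (X * B) + c * frobInner X X := by
      rw [frobInner_mul_left, ← frobInner_smul_left, ← frobInner_add_left, hM, Matrix.mul_add,
        Matrix.mul_smul, Matrix.mul_one, Matrix.mul_assoc]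
    have h0 : frobInner (X * M) X = 0 := by
      rw [hX, frobInner, Matrix.zero_mul, Matrix.trace_zero, Quaternion.re_zero]
    apply frobInner_self_eq_zero
    nlinarith [frobInner_self_nonneg (X * B), frobInner_self_nonneg X]
  obtain ⟨X, hX⟩ := LinearMap.injective_iff_surjective.mp hinj 1
  rw [LinearMap.mulRight_apply] at hX
  have hX' : M * Xᴴ = 1 := by
    rw [← Matrix.conjTranspose_one, ← hX, Matrix.conjTranspose_mul, hMM]
  exact isUnit_iff_exists_and_exists.mpr ⟨⟨_, hX'⟩, ⟨_, hX⟩⟩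

/-- The objective is quadratic around any solution of the normal equations. -/
theorem lsObj_eq_of_normal_eq {n₁ n₂ r : ℕ} {B : Matrix (Fin r) (Fin n₂) (Quaternion ℝ)}
    {C : Matrix (Fin n₁) (Fin n₂) (Quaternion ℝ)} {A₀ A' : Matrix (Fin n₁) (Fin r) (Quaternion ℝ)}
    {lam beta : ℝ}
    (h : A' * (B * Bᴴ + (lam + beta) • (1 : Matrix (Fin r) (Fin r) (Quaternion ℝ)))
      = C * Bᴴ + beta • A₀) (A : Matrix (Fin n₁) (Fin r) (Quaternion ℝ)) :
    lsObj B C A₀ lam beta A = lsObj B C A₀ lam beta A'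
      + (1 / 2) * frobM ((A - A') * B) ^ 2 + ((lam + beta) / 2) * frobM (A - A') ^ 2 := by
  obtain ⟨D, rfl⟩ : ∃ D, A = A' + D := ⟨A - A', by abel⟩
  have hG := congrArg (frobInner · D) h
  simp only [Matrix.mul_add, Matrix.mul_smul, Matrix.mul_one, ← Matrix.mul_assoc,
    frobInner_add_left, frobInner_smul_left, ← frobInner_mul_left] at hG
  have h₁ : (A' + D) * B - C = (A' * B - C) + D * B := by rw [Matrix.add_mul]; abel
  have h₂ : A' + D - A₀ = (A' - A₀) + D := by abel
  simp only [lsObj, h₁, h₂, add_sub_cancel_left, frobM_add_sq, frobInner_sub_left]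
  linear_combination hG

/-- closed-form unique minimizer of the regularized least squares problem. -/
theorem ridge_least_squares_minimizer {n₁ n₂ r : ℕ}
    (B : Matrix (Fin r) (Fin n₂) (Quaternion ℝ))
    (C : Matrix (Fin n₁) (Fin n₂) (Quaternion ℝ))
    (A₀ : Matrix (Fin n₁) (Fin r) (Quaternion ℝ))
    (lam beta : ℝ) (hlam : 0 ≤ lam) (hbeta : 0 ≤ beta) (hpos : 0 < lam + beta) :
    IsUnit (B * Bᴴ + (lam + beta) • (1 : Matrix (Fin r) (Fin r) (Quaternion ℝ))) ∧
    (∀ A : Matrix (Fin n₁) (Fin r) (Quaternion ℝ),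
        lsObj B C A₀ lam beta
          ((C * Bᴴ + beta • A₀) *
            Ring.inverse (B * Bᴴ + (lam + beta) • (1 : Matrix (Fin r) (Fin r) (Quaternion ℝ))))
          ≤ lsObj B C A₀ lam beta A) ∧
    (∀ A : Matrix (Fin n₁) (Fin r) (Quaternion ℝ),
        A ≠ (C * Bᴴ + beta • A₀) *
            Ring.inverse (B * Bᴴ + (lam + beta) • (1 : Matrix (Fin r) (Fin r) (Quaternion ℝ))) →
        lsObj B C A₀ lam beta
          ((C * Bᴴ + beta • A₀) *
            Ring.inverse (B * Bᴴ + (lam + beta) • (1 : Matrix (Fin r) (Fin r) (Quaternion ℝ))))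
          < lsObj B C A₀ lam beta A) := by
  have hU := isUnit_mul_conjTranspose_add_smul_one B hpos
  have hobj := lsObj_eq_of_normal_eq (B := B) (C := C) (A₀ := A₀) (lam := lam) (beta := beta)
    (A' := (C * Bᴴ + beta • A₀) *
      Ring.inverse (B * Bᴴ + (lam + beta) • (1 : Matrix (Fin r) (Fin r) (Quaternion ℝ))))
    (by rw [Matrix.mul_assoc, Ring.inverse_mul_cancel _ hU, Matrix.mul_one])
  refine ⟨hU, fun A => ?_, fun A hA => ?_⟩
  · rw [hobj A, add_assoc]
    exact le_add_of_nonneg_right (by positivity)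
  · rw [hobj A, add_assoc]
    refine lt_add_of_pos_right _ (add_pos_of_nonneg_of_pos (by positivity) ?_)
    refine mul_pos (by positivity) ?_
    rw [frobM_sq]
    exact (frobInner_self_nonneg _).lt_of_ne' fun h =>
      hA (sub_eq_zero.mp (frobInner_self_eq_zero h))

end QTpaper
end
end

section
/- Let N ∈ ℕ, let f : ℝ^N → ℝ be continuous, G : ℝ^N → ℝ^N, let (z^t)_{t≥0} be a sequence in ℝ^N, let z* ∈ ℝ^N be an accumulation point of (z^t), and let K₁, K₂, K₃ > 0, θ ∈ [0,1), τ > 0. Assume: (i) f(z^t) − f(z^{t+1}) ≥ K₁‖z^t − z^{t+1}‖² for all t; (ii) K₂‖z^t − z^{t+1}‖ ≥ ‖G(z^t)‖ for all t; (iii) |f(z) − f(z*)|^θ ≤ K₃‖G(z)‖ for all z ∈ B(z*, τ); (iv) f(z^t) > f(z*) for all t; and (v) z⁰ ∈ B(z*, τ) with τ > (K₂K₃/(K₁(1−θ)))·(f(z⁰) − f(z*))^{1−θ} + ‖z⁰ − z*‖. Then z^t ∈ B(z*, τ) for all t ≥ 0, the sequence has finite length with Σ_{t=0}^{∞} ‖z^{t+1}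 − z^t‖ ≤ (K₂K₃/(K₁(1−θ)))·(f(z⁰) − f(z*))^{1−θ}, and z^t → z* as t → ∞. -/
noncomputable section
open Matrix Kronecker Filter Topology

namespace QTpaper

/-- Concavity of `x ↦ x ^ (1 - θ)`: the graph lies below its tangent at `a`. -/
theorem one_sub_mul_le_rpow_mul_rpow_sub_rpow {a b θ : ℝ} (ha : 0 < a) (hb : 0 ≤ b)
    (hθ0 : 0 ≤ θ) (hθ1 : θ < 1) :
    (1 - θ) * (a - b) ≤ a ^ θ * (a ^ (1 - θ) - b ^ (1 - θ)) := by
  have hs : -1 ≤ b / a - 1 := by linarith [div_nonneg hb ha.le]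
  have h := rpow_one_add_le_one_add_mul_self hs (sub_nonneg.2 hθ1.le) (by linarith)
  rw [add_sub_cancel, Real.div_rpow hb ha.le, div_le_iff₀ (Real.rpow_pos_of_pos ha _)] at h
  have hmul : a ^ θ * a ^ (1 - θ) = a := by
    rw [← Real.rpow_add ha, add_sub_cancel, Real.rpow_one]
  have h' := mul_le_mul_of_nonneg_left h (Real.rpow_pos_of_pos ha θ).le
  have : a ^ θ * ((1 + (1 - θ) * (b / a - 1)) * a ^ (1 - θ)) = a + (1 - θ) * (b - a) := by
    rw [mul_left_comm, hmul]
    field_simp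
  rw [mul_sub (a ^ θ), hmul]
  linarith

/-- A step of length `d` that decreases the value gap from `a` to `b` by at least `K₁ * d ^ 2`,
where the gap satisfies `a ^ θ ≤ L * d`, is controlled by the decrease of the desingularized
gap. -/
theorem step_le_desingularized_decrease {a b d K₁ L θ : ℝ} (ha : 0 < a) (hb : 0 ≤ b)
    (hK₁ : 0 < K₁) (hL : 0 < L) (hθ0 : 0 ≤ θ) (hθ1 : θ < 1)
    (hdesc : K₁ * d ^ 2 ≤ a - b) (hKL : a ^ θ ≤ L * d) :
    d ≤ L / (K₁ * (1 - θ)) * a ^ (1 - θ) - L / (K₁ * (1 - θ)) * b ^ (1 - θ) := by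
  have hp : 0 < 1 - θ := sub_pos.2 hθ1
  have hd : 0 < d := pos_of_mul_pos_right ((Real.rpow_pos_of_pos ha θ).trans_le hKL) hL.le
  have hba : b ^ (1 - θ) ≤ a ^ (1 - θ) :=
    Real.rpow_le_rpow hb (by linarith [mul_pos hK₁ (pow_pos hd 2)]) hp.le
  have h₁ := one_sub_mul_le_rpow_mul_rpow_sub_rpow ha hb hθ0 hθ1
  have h₂ := mul_le_mul_of_nonneg_right hKL (sub_nonneg.2 hba)
  have h₃ := mul_le_mul_of_nonneg_left hdesc hp.le
  have h₄ : d * (K₁ * (1 - θ)) ≤ L * (a ^ (1 - θ) - b ^ (1 - θ)) :=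
    le_of_mul_le_mul_left (by linarith) hd
  rw [← mul_sub, div_mul_eq_mul_div, le_div_iff₀ (mul_pos hK₁ hp)]
  exact h₄

/-- If, inside a ball, the step lengths of a sequence are dominated by the decrease of a nonnegative
potential which is small at the start, then the sequence stays in the ball and has partial lengths
bounded by the decrease of the potential. -/
theorem mem_ball_and_sum_dist_le_of_potential {E : Type*} [SeminormedAddCommGroup E] {z : ℕ → E}
    {c : E} {τ : ℝ} {V : ℕ → ℝ} (hV : ∀ t, 0 ≤ V t)
    (hstep : ∀ t, ‖z t - c‖ < τ → ‖z (t + 1) - z t‖ ≤ V t - V (t + 1))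
    (h₀ : V 0 + ‖z 0 - c‖ < τ) (t : ℕ) :
    ‖z t - c‖ < τ ∧ ∑ i ∈ Finset.range t, ‖z (i + 1) - z i‖ ≤ V 0 - V t := by
  have key : ‖z t - c‖ ≤ ‖z 0 - c‖ + (V 0 - V t) ∧
      ∑ i ∈ Finset.range t, ‖z (i + 1) - z i‖ ≤ V 0 - V t := by
    induction t with
    | zero => simp
    | succ t ih =>
      have hs := hstep t (by linarith [ih.1, hV t])
      have htri := norm_sub_le_norm_sub_add_norm_sub (z (t + 1)) (z t) c
      rw [Finset.sum_range_succ]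
      exact ⟨by linarith [ih.1], by linarith [ih.2]⟩
  exact ⟨by linarith [key.1, hV t], key.2⟩

/-- abstract KL-based global convergence of a descent sequence. -/
theorem kl_global_convergence {N : ℕ}
    (f : EuclideanSpace ℝ (Fin N) → ℝ) (hf : Continuous f)
    (G : EuclideanSpace ℝ (Fin N) → EuclideanSpace ℝ (Fin N))
    (z : ℕ → EuclideanSpace ℝ (Fin N)) (zs : EuclideanSpace ℝ (Fin N))
    (K₁ K₂ K₃ : ℝ) (hK₁ : 0 < K₁) (hK₂ : 0 < K₂) (hK₃ : 0 < K₃)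
    (θ : ℝ) (hθ0 : 0 ≤ θ) (hθ1 : θ < 1) (τ : ℝ) (hτ : 0 < τ)
    (hacc : ∃ φ : ℕ → ℕ, StrictMono φ ∧ Tendsto (z ∘ φ) atTop (nhds zs))
    (hdesc : ∀ t : ℕ, K₁ * ‖z t - z (t + 1)‖ ^ 2 ≤ f (z t) - f (z (t + 1)))
    (hgrad : ∀ t : ℕ, ‖G (z t)‖ ≤ K₂ * ‖z t - z (t + 1)‖)
    (hKL : ∀ w : EuclideanSpace ℝ (Fin N), ‖w - zs‖ < τ →
        |f w - f zs| ^ θ ≤ K₃ * ‖G w‖)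
    (habove : ∀ t : ℕ, f zs < f (z t))
    (hball : K₂ * K₃ / (K₁ * (1 - θ)) * (f (z 0) - f zs) ^ (1 - θ) + ‖z 0 - zs‖ < τ) :
    (∀ t : ℕ, ‖z t - zs‖ < τ) ∧
    Summable (fun t : ℕ => ‖z (t + 1) - z t‖) ∧
    (∑' t : ℕ, ‖z (t + 1) - z t‖)
        ≤ K₂ * K₃ / (K₁ * (1 - θ)) * (f (z 0) - f zs) ^ (1 - θ) ∧
    Tendsto z atTop (nhds zs) := by
  obtain ⟨φ, hφ, hlim⟩ := hacc
  set C := K₂ * K₃ / (K₁ * (1 - θ))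
  have hC0 : 0 ≤ C := by
    have := sub_pos.2 hθ1
    positivity
  have hgap : ∀ t, 0 < f (z t) - f zs := fun t => sub_pos.2 (habove t)
  have hV : ∀ t, 0 ≤ C * (f (z t) - f zs) ^ (1 - θ) := fun t =>
    mul_nonneg hC0 (Real.rpow_nonneg (hgap t).le _)
  have hstep : ∀ t, ‖z t - zs‖ < τ → ‖z (t + 1) - z t‖ ≤
      C * (f (z t) - f zs) ^ (1 - θ) - C * (f (z (t + 1)) - f zs) ^ (1 - θ) := by
    intro t ht
    rw [norm_sub_rev]
    refine step_le_desingularized_decrease (hgap t) (hgap (t + 1)).le hK₁ (mul_pos hK₂ hK₃)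
      hθ0 hθ1 (by linarith [hdesc t]) ?_
    have h := hKL (z t) ht
    rw [abs_of_pos (hgap t)] at h
    linarith [mul_le_mul_of_nonneg_left (hgrad t) hK₃.le]
  have hmain := mem_ball_and_sum_dist_le_of_potential
    (V := fun t => C * (f (z t) - f zs) ^ (1 - θ)) hV hstep hball
  have hsum : ∀ t, ∑ i ∈ Finset.range t, ‖z (i + 1) - z i‖ ≤ C * (f (z 0) - f zs) ^ (1 - θ) :=
    fun t => (hmain t).2.trans (sub_le_self _ (hV t))
  have hsummable : Summable fun t => ‖z (t + 1) - z t‖ :=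
    summable_of_sum_range_le (fun _ => norm_nonneg _) hsum
  have hcauchy : CauchySeq z :=
    cauchySeq_of_summable_dist (by simpa only [dist_eq_norm, norm_sub_rev] using hsummable)
  exact ⟨fun t => (hmain t).1, hsummable,
    Real.tsum_le_of_sum_range_le (fun _ => norm_nonneg _) hsum,
    tendsto_nhds_of_cauchySeq_of_subseq hcauchy hφ.tendsto_atTop hlim⟩

end QTpaper
end
end
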